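/- Let A, B, C, D be bounded linear operators on a complex Hilbert space and r ≥ 1. Then w(A*B + C*D)^{2r} ≤ 2^{2r−3}·‖|A|^{4r} + |B|^{4r} + |C|^{4r} + |D|^{4r}‖ + 2^{2r−2}·( w(|B|²|A|²)^r + w(|D|²|C|²)^r ). -/

import Mathlib

open scoped InnerProductSpace NNReal
open ContinuousLinearMap

variable {H : Type*} [NormedAddCommGroup H] [InnerProductSpace ℂ H]

noncomputable def numRadius [CompleteSpace H] (T : H →L[ℂ] H) : ℝ :=
  ⨆ x : {x : H // ‖x‖ = 1}, ‖⟪T x, (x : H)⟫_ℂ‖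

noncomputable def opAbs [CompleteSpace H] (T : H →L[ℂ] H) : H →L[ℂ] H :=
  CFC.sqrt (ContinuousLinearMap.adjoint T * T)

theorem Real.rpow_add_mul_sub_le_rpow {s c t : ℝ} (hs : 1 ≤ s) (hc : 0 ≤ c) (ht : 0 ≤ t) :
    c ^ s + s * c ^ (s - 1) * (t - c) ≤ t ^ s := by
  rcases hc.eq_or_lt with rfl | hc
  · rcases hs.eq_or_lt with rfl | hs
    · simp
    · rw [Real.zero_rpow (by linarith), Real.zero_rpow (by linarith)]
      simpa using Real.rpow_nonneg ht s
  · have h := one_add_mul_self_le_rpow_one_add (s := t / c - 1)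
      (by linarith [div_nonneg ht hc.le]) hs
    rw [add_sub_cancel, Real.div_rpow ht hc.le, le_div_iff₀ (Real.rpow_pos_of_pos hc s)] at h
    refine le_trans (le_of_eq ?_) h
    rw [Real.rpow_sub_one hc.ne']
    field_simp

theorem Real.half_add_rpow_le {r a b : ℝ} (hr : 1 ≤ r) (ha : 0 ≤ a) (hb : 0 ≤ b) :
    (1 / 2 * (a + b)) ^ r ≤ 1 / 2 * (a ^ r + b ^ r) := by
  have h := (convexOn_rpow hr).2 (Set.mem_Ici.2 ha) (Set.mem_Ici.2 hb)
    (by norm_num : (0 : ℝ) ≤ 1 / 2) (by norm_num : (0 : ℝ) ≤ 1 / 2) (by norm_num)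
  simpa only [smul_eq_mul, ← mul_add] using h

/-- **Buzano's inequality**. -/
theorem norm_inner_mul_norm_inner_le (a b : H) {x : H} (hx : ‖x‖ = 1) :
    ‖⟪a, x⟫_ℂ‖ * ‖⟪x, b⟫_ℂ‖ ≤ 1 / 2 * (‖a‖ * ‖b‖ + ‖⟪a, b⟫_ℂ‖) := by
  have hrefl := (ℂ ∙ x).reflection.norm_map b
  have hcs := norm_inner_le_norm (𝕜 := ℂ) a ((ℂ ∙ x).reflection b)
  rw [hrefl, Submodule.reflection_singleton_apply, hx, inner_sub_right] at hcs
  simp only [RCLike.ofReal_one, one_pow, div_one, two_smul, inner_add_right,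
    inner_smul_right] at hcs
  have h := norm_le_norm_add_norm_sub' (⟪x, b⟫_ℂ * ⟪a, x⟫_ℂ + ⟪x, b⟫_ℂ * ⟪a, x⟫_ℂ) ⟪a, b⟫_ℂ
  rw [← two_mul, norm_mul, norm_mul, Complex.norm_two] at h
  rw [← two_mul] at hcs
  linarith

theorem ContinuousLinearMap.reApplyInnerSelf_le_norm (T : H →L[ℂ] H) {x : H} (hx : ‖x‖ = 1) :
    T.reApplyInnerSelf x ≤ ‖T‖ := by
  refine (RCLike.re_le_norm _).trans ((norm_inner_le_norm _ _).trans ?_)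
  simpa [hx] using T.le_opNorm x

section

variable [CompleteSpace H]

/-- **McCarthy's inequality**. -/
theorem ContinuousLinearMap.reApplyInnerSelf_rpow_le {T : H →L[ℂ] H} (hT : 0 ≤ T) {s : ℝ}
    (hs : 1 ≤ s) {x : H} (hx : ‖x‖ = 1) :
    T.reApplyInnerSelf x ^ s ≤ (T ^ s).reApplyInnerSelf x := by
  set c := T.reApplyInnerSelf x with hc
  have hc0 : 0 ≤ c := (nonneg_iff_isPositive T |>.1 hT).re_inner_nonneg_left x
  have hle : cfc (fun t : ℝ ↦ c ^ s + s * c ^ (s - 1) * (t - c)) T ≤ T ^ s := by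
    rw [CFC.rpow_eq_cfc_real hT]
    refine cfc_mono (fun t ht ↦ Real.rpow_add_mul_sub_le_rpow hs hc0 (spectrum_nonneg_of_nonneg hT ht))
      (by fun_prop) ?_
    exact (Real.continuous_rpow_const (by linarith)).continuousOn
  have hcfc : cfc (fun t : ℝ ↦ c ^ s + s * c ^ (s - 1) * (t - c)) T =
      algebraMap ℝ _ (c ^ s) + (s * c ^ (s - 1)) • (T - algebraMap ℝ _ c) := by
    rw [cfc_const_add .., cfc_const_mul .., cfc_sub .., cfc_id' .., cfc_const ..]
  rw [hcfc] at hle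
  have h := (le_def _ _ |>.1 hle).re_inner_nonneg_left x
  simp only [Algebra.algebraMap_eq_smul_one, sub_apply, add_apply, smul_apply, one_apply_eq_self,
    inner_sub_left, inner_add_left, inner_smul_left_eq_smul, map_sub, map_add, RCLike.smul_re,
    inner_self_eq_norm_sq, hx] at h
  rw [reApplyInnerSelf_apply] at hc ⊢
  rw [← hc] at h
  linarith

theorem norm_inner_le_numRadius (T : H →L[ℂ] H) {x : H} (hx : ‖x‖ = 1) :
    ‖⟪T x, x⟫_ℂ‖ ≤ numRadius T := by
  refine le_ciSup (f := fun x : {x : H // ‖x‖ = 1} ↦ ‖⟪T x, (x : H)⟫_ℂ‖) ⟨‖T‖, ?_⟩ ⟨x, hx⟩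
  rintro _ ⟨⟨y, hy⟩, rfl⟩
  refine (norm_inner_le_norm _ _).trans ?_
  simpa [hy] using T.le_opNorm y

theorem numRadius_nonneg (T : H →L[ℂ] H) : 0 ≤ numRadius T :=
  Real.iSup_nonneg fun _ ↦ norm_nonneg _

theorem opAbs_nonneg (T : H →L[ℂ] H) : 0 ≤ opAbs T := CFC.sqrt_nonneg _

theorem opAbs_sq (T : H →L[ℂ] H) : opAbs T ^ 2 = adjoint T * T := by
  rw [sq]
  exact CFC.sqrt_mul_sqrt_self _ (star_mul_self_nonneg T)

theorem adjoint_opAbs_sq (T : H →L[ℂ] H) : adjoint (opAbs T ^ 2) = opAbs T ^ 2 :=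
  ((IsSelfAdjoint.of_nonneg (opAbs_nonneg T)).pow 2).star_eq

theorem norm_inner_opAbs_sq_apply (T : H →L[ℂ] H) (x : H) :
    ‖⟪(opAbs T ^ 2) x, x⟫_ℂ‖ = ‖T x‖ ^ 2 := by
  rw [opAbs_sq, mul_apply_eq_comp, adjoint_inner_left, inner_self_eq_norm_sq_to_K]
  simp

theorem norm_opAbs_sq_apply_rpow_le (T : H →L[ℂ] H) {r : ℝ} (hr : 1 ≤ r) {x : H} (hx : ‖x‖ = 1) :
    (‖(opAbs T ^ 2) x‖ ^ r) ^ 2 ≤ (opAbs T ^ (4 * r)).reApplyInnerSelf x := by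
  have hpos : 0 ≤ opAbs T ^ 4 := CStarAlgebra.pow_nonneg (opAbs_nonneg T) 4
  have h := reApplyInnerSelf_rpow_le hpos hr hx
  have hpow : (opAbs T ^ 4) ^ r = opAbs T ^ (4 * r) := by
    rw [← CFC.rpow_natCast _ 4 (opAbs_nonneg T),
      CFC.rpow_rpow_of_exponent_nonneg _ _ _ (by norm_num) (by linarith) (opAbs_nonneg T)]
    norm_num
  have hnorm : (opAbs T ^ 4).reApplyInnerSelf x = ‖(opAbs T ^ 2) x‖ ^ 2 := by
    rw [reApplyInnerSelf_apply, show 4 = 2 + 2 from rfl, pow_add, mul_apply_eq_comp]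
    nth_rw 1 [← adjoint_opAbs_sq]
    rw [adjoint_inner_left, inner_self_eq_norm_sq]
  rwa [hpow, hnorm, ← Real.rpow_natCast_mul (norm_nonneg _), mul_comm,
    Real.rpow_mul_natCast (norm_nonneg _)] at h

theorem norm_inner_apply_rpow_le (A B : H →L[ℂ] H) {r : ℝ} (hr : 1 ≤ r) {x : H} (hx : ‖x‖ = 1) :
    ‖⟪B x, A x⟫_ℂ‖ ^ (2 * r) ≤
      1 / 4 * ((opAbs A ^ (4 * r)).reApplyInnerSelf x + (opAbs B ^ (4 * r)).reApplyInnerSelf x) +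
        1 / 2 * numRadius (opAbs B ^ 2 * opAbs A ^ 2) ^ r := by
  set w := numRadius (opAbs B ^ 2 * opAbs A ^ 2)
  have hw : 0 ≤ w := numRadius_nonneg _
  set a := (opAbs A ^ 2) x with ha
  set b := (opAbs B ^ 2) x with hb
  have hsq : ‖⟪B x, A x⟫_ℂ‖ ^ 2 ≤ 1 / 2 * (‖a‖ * ‖b‖ + w) := by
    calc ‖⟪B x, A x⟫_ℂ‖ ^ 2 ≤ (‖B x‖ * ‖A x‖) ^ 2 := by gcongr; exact norm_inner_le_norm _ _
      _ = ‖⟪a, x⟫_ℂ‖ * ‖⟪x, b⟫_ℂ‖ := by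
        rw [norm_inner_symm x b, norm_inner_opAbs_sq_apply, norm_inner_opAbs_sq_apply]; ring
      _ ≤ 1 / 2 * (‖a‖ * ‖b‖ + ‖⟪a, b⟫_ℂ‖) := norm_inner_mul_norm_inner_le a b hx
      _ ≤ 1 / 2 * (‖a‖ * ‖b‖ + w) := by
        gcongr
        rw [hb, ← adjoint_inner_left, adjoint_opAbs_sq]
        exact norm_inner_le_numRadius (opAbs B ^ 2 * opAbs A ^ 2) hx
  have hA := norm_opAbs_sq_apply_rpow_le A hr hx
  have hB := norm_opAbs_sq_apply_rpow_le B hr hx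
  have hpow := (Real.rpow_le_rpow (by positivity) hsq (by linarith)).trans
    (Real.half_add_rpow_le hr (by positivity) hw)
  rw [Real.mul_rpow (norm_nonneg _) (norm_nonneg _)] at hpow
  rw [Real.rpow_mul (norm_nonneg _), Real.rpow_two]
  nlinarith [two_mul_le_add_sq (‖a‖ ^ r) (‖b‖ ^ r)]

end

theorem stmt12 [CompleteSpace H] (A B C D : H →L[ℂ] H) (r : ℝ) (hr : 1 ≤ r) :
    numRadius (adjoint A * B + adjoint C * D) ^ (2 * r) ≤
      (2:ℝ) ^ (2 * r - 3)
          * ‖opAbs A ^ (4 * r) + opAbs B ^ (4 * r) + opAbs C ^ (4 * r) + opAbs D ^ (4 * r)‖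
        + (2:ℝ) ^ (2 * r - 2)
          * (numRadius (opAbs B ^ 2 * opAbs A ^ 2) ^ r
            + numRadius (opAbs D ^ 2 * opAbs C ^ 2) ^ r) := by
  have hwB := Real.rpow_nonneg (numRadius_nonneg (opAbs B ^ 2 * opAbs A ^ 2)) r
  have hwD := Real.rpow_nonneg (numRadius_nonneg (opAbs D ^ 2 * opAbs C ^ 2)) r
  rw [← Real.le_rpow_inv_iff_of_pos (numRadius_nonneg _) (by positivity) (by linarith)]
  refine Real.iSup_le ?_ (by positivity)
  rintro ⟨x, hx⟩
  rw [Real.le_rpow_inv_iff_of_pos (norm_nonneg _) (by positivity) (by linarith)]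
  have hAB := norm_inner_apply_rpow_le A B hr hx
  have hCD := norm_inner_apply_rpow_le C D hr hx
  have hS := reApplyInnerSelf_le_norm
    (opAbs A ^ (4 * r) + opAbs B ^ (4 * r) + opAbs C ^ (4 * r) + opAbs D ^ (4 * r)) hx
  simp only [reApplyInnerSelf_apply, add_apply, inner_add_left, map_add] at hAB hCD hS
  have htri : ‖⟪(adjoint A * B + adjoint C * D) x, x⟫_ℂ‖ ≤ 2 * (1 / 2 *
      (‖⟪B x, A x⟫_ℂ‖ + ‖⟪D x, C x⟫_ℂ‖)) := by
    rw [add_apply, inner_add_left, mul_apply_eq_comp, mul_apply_eq_comp, adjoint_inner_left,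
      adjoint_inner_left]
    linarith [norm_add_le ⟪B x, A x⟫_ℂ ⟪D x, C x⟫_ℂ]
  have hconv := Real.half_add_rpow_le (r := 2 * r) (by linarith) (norm_nonneg ⟪B x, A x⟫_ℂ)
    (norm_nonneg ⟪D x, C x⟫_ℂ)
  have h2 : (2 : ℝ) ^ (2 * r - 2) = 2 ^ (2 * r) / 4 := by
    rw [Real.rpow_sub two_pos]; norm_num
  have h3 : (2 : ℝ) ^ (2 * r - 3) = 2 ^ (2 * r) / 8 := by
    rw [Real.rpow_sub two_pos]; norm_num
  calc _ ≤ (2 * (1 / 2 * (‖⟪B x, A x⟫_ℂ‖ + ‖⟪D x, C x⟫_ℂ‖))) ^ (2 * r) :=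
        Real.rpow_le_rpow (norm_nonneg _) htri (by linarith)
    _ = 2 ^ (2 * r) * (1 / 2 * (‖⟪B x, A x⟫_ℂ‖ + ‖⟪D x, C x⟫_ℂ‖)) ^ (2 * r) :=
        Real.mul_rpow two_pos.le (by positivity)
    _ ≤ 2 ^ (2 * r) * (1 / 8 * ‖opAbs A ^ (4 * r) + opAbs B ^ (4 * r) + opAbs C ^ (4 * r) +
          opAbs D ^ (4 * r)‖ + 1 / 4 * (numRadius (opAbs B ^ 2 * opAbs A ^ 2) ^ r +
          numRadius (opAbs D ^ 2 * opAbs C ^ 2) ^ r)) := by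
        gcongr
        linarith
    _ = _ := by rw [h2, h3]; ring
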